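/- arXiv:2002.09733 — 5 statements merged into one kernel-verified Lean document; each statement's English description precedes it below -/
import Mathlib

section
/- Fix ν ∈ (0,1). For every integer j ≥ 4, the scheme coefficients satisfy Σ_{k=0}^{j−1} d_k^j = 1. -/
open Real Finset

noncomputable section

/-- α₀ = (ν+2)/(2^ν·Γ(3−ν)). -/
def alpha0 (ν : ℝ) : ℝ := (ν + 2) / ((2 : ℝ) ^ ν * Real.Gamma (3 - ν))

/-- θ = 2ν/(2+ν). -/
def theta (ν : ℝ) : ℝ := 2 * ν / (2 + ν)

/-- The coefficients D̄_k^(m). -/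
def Dbar (ν : ℝ) (m k : ℕ) : ℝ :=
  if k = 0 then
    (1 / Real.Gamma (3 - ν)) *
      (-((2 - ν) / 2) * ((2 * m : ℝ) ^ (1 - ν) + 3 * ((2 * m : ℝ) + 2) ^ (1 - ν))
        - (2 * m : ℝ) ^ (2 - ν) + ((2 * m : ℝ) + 2) ^ (2 - ν))
  else if k % 2 = 0 then
    (1 / Real.Gamma (3 - ν)) *
      (-((2 - ν) / 2) * (((2 * m : ℝ) - 2 * (k / 2 : ℕ)) ^ (1 - ν)
          + 6 * ((2 * m : ℝ) - 2 * (k / 2 : ℕ) + 2) ^ (1 - ν)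
          + ((2 * m : ℝ) - 2 * (k / 2 : ℕ) + 4) ^ (1 - ν))
        - ((2 * m : ℝ) - 2 * (k / 2 : ℕ)) ^ (2 - ν)
        + ((2 * m : ℝ) - 2 * (k / 2 : ℕ) + 4) ^ (2 - ν))
  else
    (2 / Real.Gamma (3 - ν)) *
      ((2 - ν) * (((2 * m : ℝ) - 2 * (k / 2 : ℕ)) ^ (1 - ν)
          + ((2 * m : ℝ) - 2 * (k / 2 : ℕ) + 2) ^ (1 - ν))
        + ((2 * m : ℝ) - 2 * (k / 2 : ℕ)) ^ (2 - ν)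
        - ((2 * m : ℝ) - 2 * (k / 2 : ℕ) + 2) ^ (2 - ν))

/-- The coefficients D_k^(m); for k ≥ 3 one has D_k^(m) = D̄_{k+1}^(m). -/
def Dco (ν : ℝ) (m k : ℕ) : ℝ :=
  if k = 0 then
    (1 / Real.Gamma (3 - ν)) *
      (((2 - ν) / 2) * ((2 * m : ℝ) ^ (1 - ν) - 3 * ((2 * m : ℝ) + 1) ^ (1 - ν))
        - (2 * m : ℝ) ^ (2 - ν) + ((2 * m : ℝ) + 1) ^ (2 - ν))
  else if k = 1 then
    (1 / Real.Gamma (3 - ν)) *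
      (-((2 - ν) / 2) * (((2 * m : ℝ) - 2) ^ (1 - ν) + 3 * (2 * m : ℝ) ^ (1 - ν)
          - 4 * ((2 * m : ℝ) + 1) ^ (1 - ν))
        - ((2 * m : ℝ) - 2) ^ (2 - ν) + 3 * (2 * m : ℝ) ^ (2 - ν)
        - 2 * ((2 * m : ℝ) + 1) ^ (2 - ν))
  else if k = 2 then
    (1 / Real.Gamma (3 - ν)) *
      (((2 - ν) / 2) * (4 * ((2 * m : ℝ) - 2) ^ (1 - ν) + 3 * (2 * m : ℝ) ^ (1 - ν)
          - ((2 * m : ℝ) + 1) ^ (1 - ν))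
        + 2 * ((2 * m : ℝ) - 2) ^ (2 - ν) - 3 * (2 * m : ℝ) ^ (2 - ν)
        + ((2 * m : ℝ) + 1) ^ (2 - ν))
  else Dbar ν m (k + 1)

/-- The scheme coefficients d_k^j. -/
def dco (ν : ℝ) (j k : ℕ) : ℝ :=
  if j % 2 = 1 then -Dco ν (j / 2) k / alpha0 ν
  else -Dbar ν (j / 2 - 1) k / alpha0 ν

/-- The transformed coefficients d̄_k^j. -/
def dbarco (ν : ℝ) (j k : ℕ) : ℝ :=
  if k = j then -1
  else if j = 3 then
    if k = 2 then dco ν 3 2 - theta ν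
    else if k = 1 then theta ν * (dco ν 3 2 - theta ν) + dco ν 3 1
    else theta ν * (theta ν * (dco ν 3 2 - theta ν) + dco ν 3 1) + dco ν 3 0
  else
    theta ν ^ (j - k) + ∑ k' ∈ Finset.Icc k (j - 2), dco ν j k' * theta ν ^ (k' - k)

/-- The coefficients B̄_i^n: B̄_0^n = Δx^{−ν}α₀ and
    B̄_{n−k}^n = B̄_{n−k−1}^n − Δx^{−ν}·α₀·d̄_k^n for k = n−1,…,1. -/
def Bbar (ν Δx : ℝ) (n : ℕ) : ℕ → ℝ
  | 0 => Δx ^ (-ν) * alpha0 ν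
  | i + 1 => Bbar ν Δx n i - Δx ^ (-ν) * alpha0 ν * dbarco ν n (n - (i + 1))

/-- The complementary discrete kernels P_j^n. -/
def Pker (ν Δx : ℝ) (n : ℕ) : ℕ → ℝ
  | 0 => 1 / Bbar ν Δx n 0
  | j + 1 =>
    if n ≤ j + 3 then 0
    else (1 / Bbar ν Δx (n - (j + 1)) 0) *
      ∑ k ∈ (Finset.range (j + 1)).attach,
        (Bbar ν Δx (n - k.1) (j - k.1) - Bbar ν Δx (n - k.1) (j + 1 - k.1)) * Pker ν Δx n k.1
  decreasing_by
    have := Finset.mem_range.mp k.2; omega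

/-- D̂_0, D̂_1, D̂_2, D̃_0, D̃_1, D̃_2 : first/second-step coefficients. -/
def Dhat0 (ν : ℝ) : ℝ := (3 * ν - 4) / (2 * Real.Gamma (3 - ν))
def Dhat1 (ν : ℝ) : ℝ := 2 * (1 - ν) / Real.Gamma (3 - ν)
def Dhat2 (ν : ℝ) : ℝ := ν / (2 * Real.Gamma (3 - ν))
def Dtil0 (ν : ℝ) : ℝ := (3 * ν - 2) / ((2 : ℝ) ^ ν * Real.Gamma (3 - ν))
def Dtil1 (ν : ℝ) : ℝ := -(4 * ν) / ((2 : ℝ) ^ ν * Real.Gamma (3 - ν))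
def Dtil2 (ν : ℝ) : ℝ := (ν + 2) / ((2 : ℝ) ^ ν * Real.Gamma (3 - ν))

/-- The Caputo fractional derivative of order ν. -/
def caputo (ν : ℝ) (y : ℝ → ℝ) (x : ℝ) : ℝ :=
  (1 / Real.Gamma (1 - ν)) * ∫ s in (0:ℝ)..x, (x - s) ^ (-ν) * deriv y s

/-- The discrete Caputo derivative of a function y at the grid point x_j = jΔx. -/
def discCaputo (ν Δx : ℝ) (y : ℝ → ℝ) (j : ℕ) : ℝ :=
  if j = 1 then
    Δx ^ (-ν) * (Dhat0 ν * y 0 + Dhat1 ν * y Δx + Dhat2 ν * y (2 * Δx))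
  else if j = 2 then
    Δx ^ (-ν) * (Dtil0 ν * y 0 + Dtil1 ν * y Δx + Dtil2 ν * y (2 * Δx))
  else if j % 2 = 1 then
    Δx ^ (-ν) * ((∑ k ∈ Finset.range j, Dco ν (j / 2) k * y ((k : ℝ) * Δx))
      + alpha0 ν * y ((j : ℝ) * Δx))
  else
    Δx ^ (-ν) * ((∑ k ∈ Finset.range j, Dbar ν (j / 2 - 1) k * y ((k : ℝ) * Δx))
      + alpha0 ν * y ((j : ℝ) * Δx))

/-- Truncation error r_j(Δx). -/
def trunc (ν Δx : ℝ) (y : ℝ → ℝ) (j : ℕ) : ℝ :=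
  caputo ν y ((j : ℝ) * Δx) - discCaputo ν Δx y j

/-- The Mittag–Leffler function E_ν(z) = Σ_{k≥0} z^k/Γ(1+kν). -/
def mlE (ν z : ℝ) : ℝ := ∑' k : ℕ, z ^ k / Real.Gamma (1 + (k : ℝ) * ν)

end

/-- The closed form of the partial sums of the coefficients `Dbar`, evaluated at the distance
to the last node. -/
noncomputable def partialSum (ν x : ℝ) : ℝ :=
  (1 / Real.Gamma (3 - ν)) *
    (((2 - ν) / 2) * (3 * x ^ (1 - ν) + (x + 2) ^ (1 - ν)) - (x + 2) ^ (2 - ν) + x ^ (2 - ν))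

theorem Dbar_add_Dbar_succ (ν : ℝ) (m k : ℕ) :
    Dbar ν m (2 * (k + 1)) + Dbar ν m (2 * (k + 1) + 1)
      = partialSum ν (2 * m - 2 * (k + 1 : ℕ)) - partialSum ν (2 * m - 2 * k) := by
  have h₁ : 2 * (k + 1) / 2 = k + 1 := by omega
  have h₂ : (2 * (k + 1) + 1) / 2 = k + 1 := by omega
  have h₃ : 2 * (k + 1) % 2 = 0 := by omega
  have h₄ : (2 * (k + 1) + 1) % 2 = 1 := by omega
  have e₁ : (2 * m - 2 * k : ℝ) = 2 * m - 2 * (k + 1 : ℕ) + 2 := by push_cast; ring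
  have e₂ : (2 * m - 2 * (k + 1 : ℕ) + 2 + 2 : ℝ) = 2 * m - 2 * (k + 1 : ℕ) + 4 := by ring
  rw [Dbar, Dbar, if_neg (by omega), if_pos h₃, if_neg (by omega), if_neg (by omega), h₁, h₂, e₁,
    partialSum, partialSum, e₂]
  ring

theorem sum_range_Dbar (ν : ℝ) (m K : ℕ) :
    ∑ k ∈ range (2 * (K + 1)), Dbar ν m k = partialSum ν (2 * m - 2 * K) := by
  induction K with
  | zero =>
    simp [sum_range_succ, Dbar, partialSum]
    ring
  | succ K ih =>
    rw [show 2 * (K + 1 + 1) = 2 * (K + 1) + 1 + 1 by ring, sum_range_succ, sum_range_succ, ih,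
      add_assoc, Dbar_add_Dbar_succ]
    ring

theorem sum_range_Dco (ν : ℝ) (m K : ℕ) :
    ∑ k ∈ range (2 * K + 3), Dco ν m k = partialSum ν (2 * m - 2 * (K + 1 : ℕ)) := by
  induction K with
  | zero =>
    have e : (2 * m - 2 + 2 : ℝ) = 2 * m := by ring
    simp [sum_range_succ, Dco, partialSum, e]
    ring
  | succ K ih =>
    have h₁ : Dco ν m (2 * K + 3) = Dbar ν m (2 * (K + 1 + 1)) := by
      rw [Dco, if_neg (by omega), if_neg (by omega), if_neg (by omega)]
      ring_nf
    have h₂ : Dco ν m (2 * K + 3 + 1) = Dbar ν m (2 * (K + 1 + 1) + 1) := by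
      rw [Dco, if_neg (by omega), if_neg (by omega), if_neg (by omega)]
      ring_nf
    rw [show 2 * (K + 1) + 3 = 2 * K + 3 + 1 + 1 by ring, sum_range_succ, sum_range_succ, ih,
      add_assoc, h₁, h₂, Dbar_add_Dbar_succ]
    ring

theorem partialSum_zero {ν : ℝ} (hν : ν < 1) : partialSum ν 0 = -alpha0 ν := by
  have h₁ : (2 : ℝ) ^ (1 - ν) = 2 / 2 ^ ν := by
    rw [Real.rpow_sub two_pos, Real.rpow_one]
  have h₂ : (2 : ℝ) ^ (2 - ν) = 4 / 2 ^ ν := by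
    rw [Real.rpow_sub two_pos, Real.rpow_two]
    norm_num
  have hG : Real.Gamma (3 - ν) ≠ 0 := (Real.Gamma_pos_of_pos (by linarith)).ne'
  have hp : (2 : ℝ) ^ ν ≠ 0 := (Real.rpow_pos_of_pos two_pos ν).ne'
  rw [partialSum, alpha0, zero_add, Real.zero_rpow (by linarith), Real.zero_rpow (by linarith),
    h₁, h₂]
  field_simp
  ring

theorem alpha0_pos {ν : ℝ} (hν : ν ∈ Set.Ioo (0 : ℝ) 1) : 0 < alpha0 ν :=
  div_pos (by linarith [hν.1])
    (mul_pos (Real.rpow_pos_of_pos two_pos ν) (Real.Gamma_pos_of_pos (by linarith [hν.2])))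

theorem stmt0 (ν : ℝ) (hν : ν ∈ Set.Ioo (0:ℝ) 1) (j : ℕ) (hj : 4 ≤ j) :
    ∑ k ∈ Finset.range j, dco ν j k = 1 := by
  have hα := (alpha0_pos hν).ne'
  rcases Nat.even_or_odd' j with ⟨n, rfl | rfl⟩
  · obtain ⟨m, rfl⟩ : ∃ m, n = m + 1 := ⟨n - 1, by omega⟩
    have hd (k : ℕ) : dco ν (2 * (m + 1)) k = -Dbar ν m k / alpha0 ν := by
      rw [dco, if_neg (by omega), show 2 * (m + 1) / 2 - 1 = m by omega]
    simp_rw [hd]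
    rw [← sum_div, sum_neg_distrib, sum_range_Dbar, sub_self, partialSum_zero hν.2, neg_neg,
      div_self hα]
  · obtain ⟨m, rfl⟩ : ∃ m, n = m + 1 := ⟨n - 1, by omega⟩
    have hd (k : ℕ) : dco ν (2 * (m + 1) + 1) k = -Dco ν (m + 1) k / alpha0 ν := by
      rw [dco, if_pos (by omega), show (2 * (m + 1) + 1) / 2 = m + 1 by omega]
    simp_rw [hd]
    rw [← sum_div, sum_neg_distrib, show 2 * (m + 1) + 1 = 2 * m + 3 by ring, sum_range_Dco,
      sub_self, partialSum_zero hν.2, neg_neg, div_self hα]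
end

section
/- There exists ν₀ ∈ (0,1) such that for every ν ∈ (0,1) and every integer j ≥ 4: if ν ∈ (0,ν₀) then the scheme coefficient d_{j−2}^j (formed with parameter ν) is strictly positive, and if ν ∈ (ν₀,1) then d_{j−2}^j is strictly negative. -/
open Real Finset

/-- The logarithm of the ratio `6 (2 - ν) / ((6 + ν) 2 ^ (1 - ν))`. -/
noncomputable def logRatio (x : ℝ) : ℝ :=
  Real.log (6 * (2 - x)) - Real.log (6 + x) - (1 - x) * Real.log 2

lemma hasDerivAt_logRatio {x : ℝ} (h0 : 0 ≤ x) (h1 : x ≤ 1) :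
    HasDerivAt logRatio (-1 / (2 - x) - 1 / (6 + x) + Real.log 2) x := by
  have h2 : (2 - x) ≠ 0 := by linarith
  have a : HasDerivAt (fun x : ℝ => Real.log (6 * (2 - x))) (6 * (0 - 1) / (6 * (2 - x))) x :=
    (((hasDerivAt_const x (2 : ℝ)).sub (hasDerivAt_id x)).const_mul 6).log
      (mul_ne_zero (by norm_num) h2)
  have b : HasDerivAt (fun x : ℝ => Real.log (6 + x)) (1 / (6 + x)) x :=
    ((hasDerivAt_id x).const_add 6).log (by simp only [id]; linarith)
  have c : HasDerivAt (fun x : ℝ => (1 - x) * Real.log 2) ((0 - 1) * Real.log 2) x :=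
    ((hasDerivAt_const x (1 : ℝ)).sub (hasDerivAt_id x)).mul_const _
  refine ((a.sub b).sub c).congr_deriv ?_
  field_simp
  ring

lemma continuousOn_logRatio : ContinuousOn logRatio (Set.Icc 0 1) :=
  fun _ hx => (hasDerivAt_logRatio hx.1 hx.2).continuousAt.continuousWithinAt

lemma strictConcaveOn_logRatio : StrictConcaveOn ℝ (Set.Icc 0 1) logRatio := by
  refine StrictAntiOn.strictConcaveOn_of_deriv (convex_Icc 0 1) continuousOn_logRatio ?_
  rw [interior_Icc]
  intro x hx y hy hxy
  obtain ⟨hx0, hx1⟩ := hx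
  obtain ⟨hy0, hy1⟩ := hy
  rw [(hasDerivAt_logRatio hx0.le hx1.le).deriv, (hasDerivAt_logRatio hy0.le hy1.le).deriv]
  have e : (-1 / (2 - x) - 1 / (6 + x)) - (-1 / (2 - y) - 1 / (6 + y))
      = (y - x) * (1 / ((2 - x) * (2 - y)) - 1 / ((6 + x) * (6 + y))) := by
    have : (2 - x) ≠ 0 := by linarith
    have : (2 - y) ≠ 0 := by linarith
    have : (6 + x) ≠ 0 := by linarith
    have : (6 + y) ≠ 0 := by linarith
    field_simp
    ring
  have h : 1 / ((6 + x) * (6 + y)) < 1 / ((2 - x) * (2 - y)) :=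
    one_div_lt_one_div_of_lt (mul_pos (by linarith) (by linarith)) (by nlinarith)
  have := mul_pos (sub_pos.2 hxy) (sub_pos.2 h)
  linarith

lemma logRatio_zero : logRatio 0 = 0 := by
  have : (6 * (2 - 0) : ℝ) = 6 * 2 := by norm_num
  rw [logRatio, this, Real.log_mul (by norm_num) (by norm_num)]
  simp

lemma logRatio_one_neg : logRatio 1 < 0 := by
  have : Real.log (6 * (2 - 1)) < Real.log (6 + 1) :=
    Real.log_lt_log (by norm_num) (by norm_num)
  rw [logRatio]
  linarith

lemma logRatio_one_tenth_pos : 0 < logRatio (1 / 10) := by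
  have h : Real.log (2 ^ 9 * (6 + 1 / 10) ^ 10) < Real.log ((6 * (2 - 1 / 10)) ^ 10) :=
    Real.log_lt_log (by norm_num) (by norm_num)
  rw [Real.log_mul (by norm_num) (by norm_num), Real.log_pow, Real.log_pow, Real.log_pow] at h
  push_cast at h
  rw [logRatio]
  linarith

lemma exists_logRatio_sign_change :
    ∃ c ∈ Set.Ioo (0 : ℝ) 1, ∀ x ∈ Set.Ioo (0 : ℝ) 1,
      (x < c → 0 < logRatio x) ∧ (c < x → logRatio x < 0) := by
  obtain ⟨c, ⟨hc0, hc1⟩, hc⟩ : (0 : ℝ) ∈ logRatio '' Set.Ioo (1 / 10) 1 :=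
    intermediate_value_Ioo' (by norm_num)
      (continuousOn_logRatio.mono (Set.Icc_subset_Icc_left (by norm_num)))
      ⟨logRatio_one_neg, logRatio_one_tenth_pos⟩
  have hc0' : 0 < c := by linarith
  refine ⟨c, ⟨hc0', hc1⟩, fun x ⟨hx0, hx1⟩ => ⟨fun hxc => ?_, fun hcx => ?_⟩⟩
  · have := strictConcaveOn_logRatio.slope_anti_adjacent (x := 0) (y := x) (z := c)
      (by simp) ⟨hc0'.le, hc1.le⟩ hx0 hxc
    rw [hc, logRatio_zero] at this
    by_contra! hn
    have h1 : (logRatio x - 0) / (x - 0) ≤ 0 :=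
      div_nonpos_of_nonpos_of_nonneg (by linarith) (by linarith)
    have h2 : 0 ≤ (0 - logRatio x) / (c - x) := div_nonneg (by linarith) (by linarith)
    linarith
  · have := strictConcaveOn_logRatio.slope_anti_adjacent (x := 0) (y := c) (z := x)
      (by simp) ⟨hx0.le, hx1.le⟩ hc0' hcx
    rw [hc, logRatio_zero, sub_zero, sub_zero, zero_div] at this
    by_contra! hn
    have h2 : 0 ≤ logRatio x / (x - c) := div_nonneg hn (by linarith)
    linarith

lemma logRatio_eq_log_sub_log {x : ℝ} (hx0 : 0 < x) :
    logRatio x = Real.log (6 * (2 - x)) - Real.log ((6 + x) * (2 : ℝ) ^ (1 - x)) := by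
  rw [Real.log_mul (by linarith) (Real.rpow_pos_of_pos two_pos _).ne', Real.log_rpow two_pos,
    logRatio]
  ring

lemma dco_sub_two_eq_neg_Dbar (ν : ℝ) {j : ℕ} (hj : 4 ≤ j) :
    ∃ m : ℕ, 1 ≤ m ∧ dco ν j (j - 2) = -Dbar ν m (2 * m) / alpha0 ν := by
  rcases Nat.even_or_odd' j with ⟨n, rfl | rfl⟩
  · refine ⟨n - 1, by omega, ?_⟩
    have h1 : ¬ (2 * n) % 2 = 1 := by omega
    have h2 : 2 * n / 2 - 1 = n - 1 := by omega
    have h3 : 2 * n - 2 = 2 * (n - 1) := by omega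
    rw [dco, if_neg h1, h2, h3]
  · refine ⟨n, by omega, ?_⟩
    have h1 : (2 * n + 1) % 2 = 1 := by omega
    have h2 : (2 * n + 1) / 2 = n := by omega
    have h3 : 2 * n + 1 - 2 + 1 = 2 * n := by omega
    rw [dco, if_pos h1, h2, Dco, if_neg (by omega), if_neg (by omega), if_neg (by omega), h3]

lemma neg_Dbar_two_mul {ν : ℝ} (hν : ν < 1) {m : ℕ} (hm : 1 ≤ m) :
    -Dbar ν m (2 * m) = (2 : ℝ) ^ (1 - ν) / (2 * Real.Gamma (3 - ν)) *
      (6 * (2 - ν) - (6 + ν) * (2 : ℝ) ^ (1 - ν)) := by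
  have h4 : (4 : ℝ) ^ (1 - ν) = (2 : ℝ) ^ (1 - ν) * (2 : ℝ) ^ (1 - ν) := by
    rw [← Real.mul_rpow (by norm_num) (by norm_num)]
    norm_num
  have h5 : (4 : ℝ) ^ (2 - ν) = 4 * (4 : ℝ) ^ (1 - ν) := by
    rw [show 2 - ν = 1 + (1 - ν) by ring, Real.rpow_add (by norm_num), Real.rpow_one]
  have h6 : Real.Gamma (3 - ν) ≠ 0 := (Real.Gamma_pos_of_pos (by linarith)).ne'
  rw [Dbar, if_neg (by omega), if_pos (by omega), Nat.mul_div_cancel_left m two_pos, sub_self,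
    zero_add, zero_add, Real.zero_rpow (by linarith), Real.zero_rpow (by linarith), h5, h4]
  field_simp
  ring

theorem stmt3 :
    ∃ ν₀ ∈ Set.Ioo (0:ℝ) 1, ∀ ν ∈ Set.Ioo (0:ℝ) 1, ∀ j : ℕ, 4 ≤ j →
      (ν < ν₀ → 0 < dco ν j (j - 2)) ∧ (ν₀ < ν → dco ν j (j - 2) < 0) := by
  obtain ⟨c, hc, H⟩ := exists_logRatio_sign_change
  refine ⟨c, hc, fun ν hν j hj => ?_⟩
  obtain ⟨hpos, hneg⟩ := H ν hν
  obtain ⟨hν0, hν1⟩ := hν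
  obtain ⟨m, hm, e⟩ := dco_sub_two_eq_neg_Dbar ν hj
  have hG : 0 < Real.Gamma (3 - ν) := Real.Gamma_pos_of_pos (by linarith)
  have hα : 0 < alpha0 ν := by unfold alpha0; positivity
  have hp : 0 < (6 + ν) * (2 : ℝ) ^ (1 - ν) := by positivity
  have hq : 0 < 6 * (2 - ν) := by linarith
  have hf : 0 < (2 : ℝ) ^ (1 - ν) / (2 * Real.Gamma (3 - ν)) := by positivity
  rw [logRatio_eq_log_sub_log hν0] at hpos hneg
  rw [e, neg_Dbar_two_mul hν1 hm]
  refine ⟨fun h => div_pos (mul_pos hf (sub_pos.2 ?_)) hα,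
    fun h => div_neg_of_neg_of_pos (mul_neg_of_pos_of_neg hf (sub_neg.2 ?_)) hα⟩
  · exact (Real.log_lt_log_iff hp hq).1 (sub_pos.1 (hpos h))
  · exact (Real.log_lt_log_iff hq hp).1 (sub_neg.1 (hneg h))
end

section
/- Fix ν ∈ (0,1). For every integer j ≥ 4, the scheme coefficients satisfy (1/4)·(d_{j−1}^j)² + d_{j−2}^j > (2^{−ν}·ν)/(8·α₀·Γ(1−ν)) > 0. -/
open Real Finset

theorem Dbar_top_odd (ν : ℝ) (hν : ν < 1) (m : ℕ) :
    Dbar ν m (2 * m + 1) = (2 / Real.Gamma (3 - ν)) * (-ν * (2 : ℝ) ^ (1 - ν)) := by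
  have h1 : (2 * m + 1) % 2 ≠ 0 := by omega
  have h2 : (2 * m + 1) / 2 = m := by omega
  have h3 : (0 : ℝ) ^ (1 - ν) = 0 := Real.zero_rpow (by linarith)
  have h4 : (0 : ℝ) ^ (2 - ν) = 0 := Real.zero_rpow (by linarith)
  have h5 : (2 : ℝ) ^ (2 - ν) = 2 * 2 ^ (1 - ν) := by
    rw [show 2 - ν = 1 + (1 - ν) by ring, Real.rpow_add two_pos, Real.rpow_one]
  rw [Dbar, if_neg (by omega), if_neg h1, h2, sub_self, zero_add, h3, h4, h5]
  ring

theorem Dbar_top_even (ν : ℝ) (hν : ν < 1) (m : ℕ) (hm : 1 ≤ m) :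
    Dbar ν m (2 * m) = (1 / Real.Gamma (3 - ν)) *
      (-((2 - ν) / 2) * (6 * (2 : ℝ) ^ (1 - ν) + (4 : ℝ) ^ (1 - ν)) + (4 : ℝ) ^ (2 - ν)) := by
  have h1 : (2 * m) % 2 = 0 := by omega
  have h2 : (2 * m) / 2 = m := by omega
  have h3 : (0 : ℝ) ^ (1 - ν) = 0 := Real.zero_rpow (by linarith)
  have h4 : (0 : ℝ) ^ (2 - ν) = 0 := Real.zero_rpow (by linarith)
  rw [Dbar, if_neg (by omega), if_pos h1, h2, sub_self, zero_add, zero_add, h3, h4]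
  ring

theorem dco_eq_neg_Dbar_div (ν : ℝ) (j : ℕ) (hj : 4 ≤ j) : ∃ m : ℕ, 1 ≤ m ∧
    dco ν j (j - 1) = -Dbar ν m (2 * m + 1) / alpha0 ν ∧
    dco ν j (j - 2) = -Dbar ν m (2 * m) / alpha0 ν := by
  rcases Nat.even_or_odd' j with ⟨n, rfl | rfl⟩
  · refine ⟨n - 1, by omega, ?_, ?_⟩ <;> rw [dco, if_neg (by omega)] <;>
      congr 3 <;> omega
  · refine ⟨n, by omega, ?_, ?_⟩ <;>
      rw [dco, if_pos (by omega), Dco, if_neg (by omega), if_neg (by omega), if_neg (by omega)] <;>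
      congr 3 <;> omega

theorem Gamma_three_sub (ν : ℝ) (hν : ν < 1) :
    Real.Gamma (3 - ν) = (2 - ν) * ((1 - ν) * Real.Gamma (1 - ν)) := by
  rw [show 3 - ν = (1 - ν + 1) + 1 by ring, Real.Gamma_add_one (by linarith),
    Real.Gamma_add_one (by linarith)]
  ring

theorem two_rpow_quadratic_le {ν : ℝ} (hν : 0 ≤ ν) :
    1 + 0.693 * ν + (0.693 * ν) ^ 2 / 2 ≤ (2 : ℝ) ^ ν := by
  have hlog := Real.log_two_gt_d9
  calc 1 + 0.693 * ν + (0.693 * ν) ^ 2 / 2 ≤ Real.exp (0.693 * ν) :=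
        Real.quadratic_le_exp_of_nonneg (by positivity)
    _ ≤ Real.exp (Real.log 2 * ν) := by
        gcongr
        linarith
    _ = (2 : ℝ) ^ ν := (Real.rpow_def_of_pos two_pos ν).symm

theorem two_rpow_mul_gt {ν : ℝ} (h0 : 0 < ν) (h1 : ν < 1) :
    (12 + 2 * ν) * (ν + 2) <
      (4 * ν ^ 2 + (ν + 2) * (12 - 6 * ν - ν * (2 - ν) * (1 - ν) / 8)) * (2 : ℝ) ^ ν := by
  have hA : 0 ≤ 4 * ν ^ 2 + (ν + 2) * (12 - 6 * ν - ν * (2 - ν) * (1 - ν) / 8) := by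
    have : ν * (2 - ν) * (1 - ν) ≤ 2 := by nlinarith [mul_pos h0 (sub_pos.2 h1)]
    have : 0 ≤ 12 - 6 * ν - ν * (2 - ν) * (1 - ν) / 8 := by linarith
    positivity
  refine lt_of_lt_of_le ?_ (mul_le_mul_of_nonneg_left (two_rpow_quadratic_le h0.le) hA)
  have hsq : 0 < ν ^ 2 := by positivity
  have hpow : ∀ k, 2 ≤ k → ν ^ k ≤ ν ^ 2 := fun k hk => pow_le_pow_of_le_one h0.le h1.le hk
  nlinarith [hpow 3 (by norm_num), hpow 4 (by norm_num), hpow 5 (by norm_num),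
    hpow 6 (by norm_num)]

theorem stmt4 (ν : ℝ) (hν : ν ∈ Set.Ioo (0:ℝ) 1) (j : ℕ) (hj : 4 ≤ j) :
    (1 / 4) * (dco ν j (j - 1)) ^ 2 + dco ν j (j - 2)
      > (2 : ℝ) ^ (-ν) * ν / (8 * alpha0 ν * Real.Gamma (1 - ν))
    ∧ (2 : ℝ) ^ (-ν) * ν / (8 * alpha0 ν * Real.Gamma (1 - ν)) > 0 := by
  obtain ⟨h0, h1⟩ := hν
  obtain ⟨m, hm, e1, e2⟩ := dco_eq_neg_Dbar_div ν j hj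
  have hG : 0 < Real.Gamma (1 - ν) := Real.Gamma_pos_of_pos (by linarith)
  have hα : 0 < alpha0 ν := by
    have : 0 < Real.Gamma (3 - ν) := Real.Gamma_pos_of_pos (by linarith)
    unfold alpha0
    positivity
  refine ⟨?_, by positivity⟩
  have hx : (0 : ℝ) < 2 ^ ν := by positivity
  have r1 : (2 : ℝ) ^ (1 - ν) = 2 / 2 ^ ν := by rw [Real.rpow_sub two_pos, Real.rpow_one]
  have r4 : (4 : ℝ) ^ ν = 2 ^ ν * 2 ^ ν := by
    rw [show (4 : ℝ) = 2 * 2 by norm_num, Real.mul_rpow two_pos.le two_pos.le]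
  have r2 : (4 : ℝ) ^ (1 - ν) = 4 / (2 ^ ν * 2 ^ ν) := by
    rw [Real.rpow_sub four_pos, Real.rpow_one, r4]
  have r3 : (4 : ℝ) ^ (2 - ν) = 16 / (2 ^ ν * 2 ^ ν) := by
    rw [Real.rpow_sub four_pos, r4]
    norm_num
  have key := two_rpow_mul_gt h0 h1
  rw [e1, e2, Dbar_top_odd ν h1, Dbar_top_even ν h1 m hm, r1, r2, r3, Real.rpow_neg two_pos.le,
    alpha0, Gamma_three_sub ν h1]
  have h1' : 0 < 1 - ν := by linarith
  have h2' : 0 < 2 - ν := by linarith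
  generalize Real.Gamma (1 - ν) = G at *
  generalize (2 : ℝ) ^ ν = x at *
  rw [gt_iff_lt, ← sub_pos]
  have : 0 < ((4 * ν ^ 2 + (ν + 2) * (12 - 6 * ν - ν * (2 - ν) * (1 - ν) / 8)) * x
      - (12 + 2 * ν) * (ν + 2)) / (x * (ν + 2) ^ 2) :=
    div_pos (sub_pos.2 key) (by positivity)
  convert this using 1
  field_simp
  ring
end

section
/- Fix ν ∈ (0,1). The transformed coefficients satisfy 0 < d̄_2^3 < θ < 2/3. -/
open Real Finset

theorem strictConcaveOn_log_add_sub_log_sub :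
    StrictConcaveOn ℝ (Set.Icc (0 : ℝ) 1) fun x => Real.log (4 + x) - Real.log (6 - x) := by
  have hd : ∀ x ∈ Set.Ioo (0 : ℝ) 1,
      deriv (fun x => Real.log (4 + x) - Real.log (6 - x)) x = 10 / ((4 + x) * (6 - x)) := by
    rintro x ⟨h0, h1⟩
    have h4 : 4 + x ≠ 0 := by linarith
    have h6 : 6 - x ≠ 0 := by linarith
    have h := (((hasDerivAt_id x).const_add 4).log h4).sub (((hasDerivAt_id x).const_sub 6).log h6)
    refine h.deriv.trans ?_
    simp only [id]
    field_simp
    ring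
  refine StrictAntiOn.strictConcaveOn_of_deriv (convex_Icc 0 1) ?_ ?_
  · refine ContinuousOn.sub (ContinuousOn.log (by fun_prop) ?_) (ContinuousOn.log (by fun_prop) ?_)
    · rintro x ⟨h0, h1⟩; linarith
    · rintro x ⟨h0, h1⟩; linarith
  · rw [interior_Icc]
    intro x hx y hy hxy
    rw [hd x hx, hd y hy]
    obtain ⟨hx0, hx1⟩ := hx
    obtain ⟨hy0, hy1⟩ := hy
    refine div_lt_div_of_pos_left (by norm_num) (mul_pos (by linarith) (by linarith)) ?_
    nlinarith

theorem lt_two_thirds_rpow {ν : ℝ} (h0 : 0 < ν) (h1 : ν < 1) :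
    2 / 3 * (6 - ν) / (4 + ν) < (2 / 3 : ℝ) ^ ν := by
  have h := strictConcaveOn_log_add_sub_log_sub.2 (Set.left_mem_Icc.2 zero_le_one)
    (Set.right_mem_Icc.2 zero_le_one) zero_ne_one (sub_pos.2 h1) h0 (sub_add_cancel 1 ν)
  have e0 : Real.log 4 - Real.log (6 - 0) = Real.log (2 / 3) := by
    rw [← Real.log_div (by norm_num) (by norm_num)]; norm_num
  have e1 : Real.log (4 + 1) - Real.log (6 - 1) = 0 := by norm_num
  simp only [smul_eq_mul, mul_zero, mul_one, zero_add, e1, add_zero, e0] at h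
  have h4 : 0 < 4 + ν := by linarith
  have h6 : 0 < 6 - ν := by linarith
  rw [Real.lt_rpow_iff_log_lt (by positivity) (by norm_num),
    Real.log_div (by positivity) h4.ne', Real.log_mul (by norm_num) h6.ne']
  linarith

theorem two_thirds_rpow_le {ν : ℝ} (h0 : 0 ≤ ν) (h1 : ν ≤ 1) :
    (2 / 3 : ℝ) ^ ν ≤ 1 - ν / 3 := by
  have h := rpow_one_add_le_one_add_mul_self (s := -1 / 3) (by norm_num) h0 h1
  norm_num at h
  linarith

theorem dbarco_three_two {ν : ℝ} (h0 : 0 < ν) (h1 : ν < 1) :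
    dbarco ν 3 2 = (6 + ν - 3 / 2 * (2 / 3 : ℝ) ^ ν * (4 + ν)) / (2 + ν) := by
  have hΓ : Real.Gamma (3 - ν) ≠ 0 := (Real.Gamma_pos_of_pos (by linarith)).ne'
  have h2ν : 2 + ν ≠ 0 := by linarith
  have hν2 : ν + 2 ≠ 0 := by linarith
  have h2 : (2 : ℝ) ^ ν ≠ 0 := by positivity
  have h3 : (3 : ℝ) ^ ν ≠ 0 := by positivity
  have z1 : (0 : ℝ) ^ (1 - ν) = 0 := Real.zero_rpow (by linarith)
  have z2 : (0 : ℝ) ^ (2 - ν) = 0 := Real.zero_rpow (by linarith)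
  have a1 : (2 : ℝ) ^ (1 - ν) = 2 / 2 ^ ν := by rw [Real.rpow_sub (by norm_num), Real.rpow_one]
  have a2 : (2 : ℝ) ^ (2 - ν) = 4 / 2 ^ ν := by
    rw [Real.rpow_sub (by norm_num), Real.rpow_two]; norm_num
  have b1 : (3 : ℝ) ^ (1 - ν) = 3 / 3 ^ ν := by rw [Real.rpow_sub (by norm_num), Real.rpow_one]
  have b2 : (3 : ℝ) ^ (2 - ν) = 9 / 3 ^ ν := by
    rw [Real.rpow_sub (by norm_num), Real.rpow_two]; norm_num
  have e3 : (2 : ℝ) * ((1 : ℕ) : ℝ) + 1 = 3 := by norm_num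
  have e2 : (2 : ℝ) * ((1 : ℕ) : ℝ) = 2 := by norm_num
  have hd : dbarco ν 3 2 = -Dco ν 1 2 / alpha0 ν - theta ν := by simp [dbarco, dco]
  rw [hd, Dco, if_neg (by norm_num), if_neg (by norm_num), if_pos rfl, e3, e2, sub_self,
    z1, z2, a1, a2, b1, b2, alpha0, theta, Real.div_rpow (by norm_num) (by norm_num)]
  field_simp
  ring

theorem stmt5 (ν : ℝ) (hν : ν ∈ Set.Ioo (0:ℝ) 1) :
    0 < dbarco ν 3 2 ∧ dbarco ν 3 2 < theta ν ∧ theta ν < 2 / 3 := by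
  obtain ⟨h0, h1⟩ := hν
  have h2 : 0 < 2 + ν := by linarith
  rw [dbarco_three_two h0 h1, theta]
  refine ⟨div_pos ?_ h2, (div_lt_div_iff_of_pos_right h2).2 ?_, ?_⟩
  · nlinarith [mul_le_mul_of_nonneg_right (two_thirds_rpow_le h0.le h1.le)
      (by linarith : 0 ≤ 4 + ν)]
  · have h := lt_two_thirds_rpow h0 h1
    rw [div_lt_iff₀ (by linarith)] at h
    linarith
  · rw [div_lt_iff₀ h2]
    linarith
end

section
/- Fix ν ∈ (0,1). For every integer j ≥ 3, the transformed coefficients satisfy θ + Σ_{k=0}^{j−2} d̄_k^j < 1. -/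
open Real Finset

/-- A function vanishing to first order at `0` with nonnegative second derivative is nonnegative. -/
lemma nonneg_of_second_deriv_nonneg {g g' g'' : ℝ → ℝ} {b : ℝ} (hb : 0 ≤ b)
    (h1 : ∀ x ∈ Set.Icc 0 b, HasDerivAt g (g' x) x)
    (h2 : ∀ x ∈ Set.Icc 0 b, HasDerivAt g' (g'' x) x)
    (h0 : g 0 = 0) (h0' : g' 0 = 0) (h : ∀ x ∈ Set.Icc 0 b, 0 ≤ g'' x) : 0 ≤ g b := by
  have mono : ∀ {f f' : ℝ → ℝ}, (∀ x ∈ Set.Icc 0 b, HasDerivAt f (f' x) x) →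
      (∀ x ∈ Set.Icc 0 b, 0 ≤ f' x) → MonotoneOn f (Set.Icc 0 b) := by
    intro f f' hf hf'
    refine monotoneOn_of_hasDerivWithinAt_nonneg (f' := f') (convex_Icc 0 b)
      (fun x hx => (hf x hx).continuousAt.continuousWithinAt) ?_ ?_
    · intro x hx
      exact (hf x (interior_subset hx)).hasDerivWithinAt
    · intro x hx
      exact hf' x (interior_subset hx)
  have h0b : (0 : ℝ) ∈ Set.Icc 0 b := ⟨le_rfl, hb⟩
  have h1' : ∀ x ∈ Set.Icc 0 b, 0 ≤ g' x := fun x hx => by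
    have := mono h2 h h0b hx hx.1
    rwa [h0'] at this
  have := mono h1 h1' h0b ⟨hb, le_rfl⟩ hb
  rwa [h0] at this

lemma hasDerivAt_affine_rpow {c s x r r' : ℝ} (h : 0 < c + s * x) (hr : r' = r - 1) :
    HasDerivAt (fun y => (c + s * y) ^ r) (r * s * (c + s * x) ^ r') x := by
  have h1 : HasDerivAt (fun y : ℝ => c + s * y) s x := by
    simpa using ((hasDerivAt_id x).const_mul s).const_add c
  have := h1.rpow_const (p := r) (Or.inl h.ne')
  rw [hr]
  convert this using 1
  ring

lemma rpow_neg_eq_mul_rpow {x ν : ℝ} (hx : 0 < x) : x ^ (-ν) = x * x ^ (-ν - 1) := by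
  rw [rpow_sub_one hx.ne']
  field_simp

lemma rpow_neg_sub_one_le {A B ν : ℝ} (hA : 0 < A) (hAB : A ≤ B) (h0 : 0 < ν) (h1 : ν < 1) :
    B ^ (-ν - 1) * B ^ 2 ≤ A ^ (-ν - 1) * (A * (B - ν * (B - A))) := by
  have hB : 0 < B := hA.trans_le hAB
  have key : (A / B) ^ ν ≤ 1 + ν * (A / B - 1) := by
    have := rpow_one_add_le_one_add_mul_self (s := A / B - 1) (p := ν)
      (by have : 0 < A / B := by positivity
          linarith) h0.le h1.le
    simpa using this
  have e : B ^ (-ν - 1) * B ^ 2 = A ^ (-ν - 1) * (A * (B * (A / B) ^ ν)) := by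
    rw [div_rpow hA.le hB.le, rpow_sub_one hA.ne', rpow_sub_one hB.ne', rpow_neg hA.le,
      rpow_neg hB.le]
    have := rpow_pos_of_pos hA ν
    have := rpow_pos_of_pos hB ν
    field_simp
  rw [e]
  have e2 : B - ν * (B - A) = B * (1 + ν * (A / B - 1)) := by field_simp; ring
  rw [e2]
  gcongr

section
variable {ν : ℝ}

/-- Trapezoidal rule for `t ↦ t ^ (1 - ν)`. -/
lemma trapezoid_rpow_le (h0 : 0 < ν) (h1 : ν < 1) {a : ℝ} (ha : 0 ≤ a) :
    (2 - ν) * (a ^ (1 - ν) + (a + 2) ^ (1 - ν)) + a ^ (2 - ν) - (a + 2) ^ (2 - ν) ≤ 0 := by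
  rcases ha.eq_or_lt with rfl | ha
  · have e : (2 : ℝ) ^ (2 - ν) = 2 * 2 ^ (1 - ν) := by
      rw [show 2 - ν = 1 + (1 - ν) by ring, rpow_add two_pos, rpow_one]
    rw [zero_rpow (by linarith), zero_rpow (by linarith), zero_add, zero_add, e]
    have := rpow_pos_of_pos two_pos (1 - ν)
    nlinarith
  have := nonneg_of_second_deriv_nonneg (b := 2) (by norm_num)
    (g := fun h => (a + 1 * h) ^ (2 - ν) - a ^ (2 - ν)
      - (2 - ν) * (h / 2) * (a ^ (1 - ν) + (a + 1 * h) ^ (1 - ν)))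
    (g' := fun h => (2 - ν) * 1 * (a + 1 * h) ^ (1 - ν)
      - ((2 - ν) * (1 / 2) * (a ^ (1 - ν) + (a + 1 * h) ^ (1 - ν))
        + (2 - ν) * (h / 2) * ((1 - ν) * 1 * (a + 1 * h) ^ (-ν))))
    (g'' := fun h => (2 - ν) * (1 - ν) * ν * (h / 2) * (a + 1 * h) ^ (-ν - 1)) ?_ ?_ (by simp)
    (by simp; ring) ?_
  · norm_num at this
    linarith
  · rintro h ⟨hh, -⟩
    have hp : 0 < a + 1 * h := by linarith
    have dF := hasDerivAt_affine_rpow hp (show 1 - ν = (2 - ν) - 1 by ring)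
    have df := hasDerivAt_affine_rpow hp (show -ν = (1 - ν) - 1 by ring)
    exact (dF.sub_const _).sub
      ((((hasDerivAt_id' h).div_const 2).const_mul (2 - ν)).mul (df.const_add _))
  · rintro h ⟨hh, -⟩
    have hp : 0 < a + 1 * h := by linarith
    have df := hasDerivAt_affine_rpow hp (show -ν = (1 - ν) - 1 by ring)
    have dd := hasDerivAt_affine_rpow hp (show -ν - 1 = -ν - 1 by ring)
    refine ((df.const_mul ((2 - ν) * 1)).sub (((df.const_add (a ^ (1 - ν))).const_mul
      ((2 - ν) * (1 / 2))).add ((((hasDerivAt_id' h).div_const 2).const_mul (2 - ν)).mul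
        (dd.const_mul ((1 - ν) * 1))))).congr_deriv ?_
    ring
  · rintro h ⟨hh, -⟩
    have : 0 < a + 1 * h := by linarith
    have := rpow_pos_of_pos this (-ν - 1)
    have : 0 < 1 - ν := by linarith
    have : 0 < 2 - ν := by linarith
    positivity

lemma Dbar_zero_aux (h0 : 0 < ν) (h1 : ν < 1) {a : ℝ} (ha : 2 ≤ a) :
    -((2 - ν) / 2) * (a ^ (1 - ν) + 3 * (a + 2) ^ (1 - ν)) - a ^ (2 - ν) + (a + 2) ^ (2 - ν)
      ≤ 0 := by
  have := nonneg_of_second_deriv_nonneg (b := 2) (by norm_num)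
    (g := fun h => (2 - ν) * (h / 4) * (a ^ (1 - ν) + 3 * (a + 1 * h) ^ (1 - ν))
      - ((a + 1 * h) ^ (2 - ν) - a ^ (2 - ν)))
    (g' := fun h => ((2 - ν) * (1 / 4) * (a ^ (1 - ν) + 3 * (a + 1 * h) ^ (1 - ν))
        + (2 - ν) * (h / 4) * (3 * ((1 - ν) * 1 * (a + 1 * h) ^ (-ν))))
      - (2 - ν) * 1 * (a + 1 * h) ^ (1 - ν))
    (g'' := fun h => (2 - ν) * (1 - ν) * ((a + 1 * h) ^ (-ν - 1)
      * (1 / 2 * (a + 1 * h) - 3 / 4 * (h * ν)))) ?_ ?_ (by simp)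
    (by simp; ring) ?_
  · norm_num at this
    linarith
  · rintro h ⟨hh, -⟩
    have hp : 0 < a + 1 * h := by linarith
    have dF := hasDerivAt_affine_rpow hp (show 1 - ν = (2 - ν) - 1 by ring)
    have df := hasDerivAt_affine_rpow hp (show -ν = (1 - ν) - 1 by ring)
    exact ((((hasDerivAt_id' h).div_const 4).const_mul (2 - ν)).mul
      ((df.const_mul 3).const_add _)).sub (dF.sub_const _)
  · rintro h ⟨hh, -⟩
    have hp : 0 < a + 1 * h := by linarith
    have df := hasDerivAt_affine_rpow hp (show -ν = (1 - ν) - 1 by ring)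
    have dd := hasDerivAt_affine_rpow hp (show -ν - 1 = -ν - 1 by ring)
    refine (((((df.const_mul 3).const_add (a ^ (1 - ν))).const_mul ((2 - ν) * (1 / 4))).add
      ((((hasDerivAt_id' h).div_const 4).const_mul (2 - ν)).mul
        ((dd.const_mul ((1 - ν) * 1)).const_mul 3))).sub
        (df.const_mul ((2 - ν) * 1))).congr_deriv ?_
    rw [rpow_neg_eq_mul_rpow hp]
    ring
  · rintro h ⟨hh, hh2⟩
    have hp : 0 < a + 1 * h := by linarith
    have := rpow_pos_of_pos hp (-ν - 1)
    have : 0 < 1 - ν := by linarith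
    have : 0 < 2 - ν := by linarith
    have : 0 ≤ 1 / 2 * (a + 1 * h) - 3 / 4 * (h * ν) := by nlinarith
    positivity

lemma Dco_zero_aux (h0 : 0 < ν) (h1 : ν < 1) {a : ℝ} (ha : 2 ≤ a) :
    ((2 - ν) / 2) * (a ^ (1 - ν) - 3 * (a + 1) ^ (1 - ν)) - a ^ (2 - ν) + (a + 1) ^ (2 - ν)
      ≤ 0 := by
  have := nonneg_of_second_deriv_nonneg (b := 1) (by norm_num)
    (g := fun h => (2 - ν) * (h / 2) * (-a ^ (1 - ν) + 3 * (a + 1 * h) ^ (1 - ν))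
      - ((a + 1 * h) ^ (2 - ν) - a ^ (2 - ν)))
    (g' := fun h => ((2 - ν) * (1 / 2) * (-a ^ (1 - ν) + 3 * (a + 1 * h) ^ (1 - ν))
        + (2 - ν) * (h / 2) * (3 * ((1 - ν) * 1 * (a + 1 * h) ^ (-ν))))
      - (2 - ν) * 1 * (a + 1 * h) ^ (1 - ν))
    (g'' := fun h => (2 - ν) * (1 - ν) * ((a + 1 * h) ^ (-ν - 1)
      * (2 * (a + 1 * h) - 3 / 2 * (h * ν)))) ?_ ?_ (by simp)
    (by simp; ring) ?_
  · norm_num at this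
    linarith
  · rintro h ⟨hh, -⟩
    have hp : 0 < a + 1 * h := by linarith
    have dF := hasDerivAt_affine_rpow hp (show 1 - ν = (2 - ν) - 1 by ring)
    have df := hasDerivAt_affine_rpow hp (show -ν = (1 - ν) - 1 by ring)
    exact ((((hasDerivAt_id' h).div_const 2).const_mul (2 - ν)).mul
      ((df.const_mul 3).const_add _)).sub (dF.sub_const _)
  · rintro h ⟨hh, -⟩
    have hp : 0 < a + 1 * h := by linarith
    have df := hasDerivAt_affine_rpow hp (show -ν = (1 - ν) - 1 by ring)
    have dd := hasDerivAt_affine_rpow hp (show -ν - 1 = -ν - 1 by ring)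
    refine (((((df.const_mul 3).const_add (-a ^ (1 - ν))).const_mul ((2 - ν) * (1 / 2))).add
      ((((hasDerivAt_id' h).div_const 2).const_mul (2 - ν)).mul
        ((dd.const_mul ((1 - ν) * 1)).const_mul 3))).sub
        (df.const_mul ((2 - ν) * 1))).congr_deriv ?_
    rw [rpow_neg_eq_mul_rpow hp]
    ring
  · rintro h ⟨hh, hh2⟩
    have hp : 0 < a + 1 * h := by linarith
    have := rpow_pos_of_pos hp (-ν - 1)
    have : 0 < 1 - ν := by linarith
    have : 0 < 2 - ν := by linarith
    have : 0 ≤ 2 * (a + 1 * h) - 3 / 2 * (h * ν) := by nlinarith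
    positivity

lemma Dbar_even_aux (h0 : 0 < ν) (h1 : ν < 1) {a : ℝ} (ha : 2 ≤ a) :
    -((2 - ν) / 2) * (a ^ (1 - ν) + 6 * (a + 2) ^ (1 - ν) + (a + 4) ^ (1 - ν))
      - a ^ (2 - ν) + (a + 4) ^ (2 - ν) ≤ 0 := by
  have := nonneg_of_second_deriv_nonneg (b := 2) (by norm_num)
    (g := fun h => (2 - ν) * (h / 4) * ((a + 2 + (-1) * h) ^ (1 - ν)
        + (6 * (a + 2) ^ (1 - ν) + (a + 2 + 1 * h) ^ (1 - ν)))
      - ((a + 2 + 1 * h) ^ (2 - ν) - (a + 2 + (-1) * h) ^ (2 - ν)))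
    (g' := fun h => ((2 - ν) * (1 / 4) * ((a + 2 + (-1) * h) ^ (1 - ν)
        + (6 * (a + 2) ^ (1 - ν) + (a + 2 + 1 * h) ^ (1 - ν)))
        + (2 - ν) * (h / 4) * ((1 - ν) * (-1) * (a + 2 + (-1) * h) ^ (-ν)
          + (1 - ν) * 1 * (a + 2 + 1 * h) ^ (-ν)))
      - ((2 - ν) * 1 * (a + 2 + 1 * h) ^ (1 - ν)
        - (2 - ν) * (-1) * (a + 2 + (-1) * h) ^ (1 - ν)))
    (g'' := fun h => (2 - ν) * (1 - ν) / 2 *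
      ((a + 2 + (-1) * h) ^ (-ν - 1) * (a + 2 + (-1) * h - ν * h / 2)
        - (a + 2 + 1 * h) ^ (-ν - 1) * (a + 2 + 1 * h + ν * h / 2))) ?_ ?_ (by simp)
    (by simp; ring) ?_
  · norm_num at this
    rw [show a + 2 + 2 = a + 4 by ring] at this
    linarith
  · rintro h ⟨hh, hh2⟩
    have hp : 0 < a + 2 + 1 * h := by linarith
    have hm : 0 < a + 2 + (-1) * h := by linarith
    have dFp := hasDerivAt_affine_rpow hp (show 1 - ν = (2 - ν) - 1 by ring)
    have dfp := hasDerivAt_affine_rpow hp (show -ν = (1 - ν) - 1 by ring)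
    have dFm := hasDerivAt_affine_rpow hm (show 1 - ν = (2 - ν) - 1 by ring)
    have dfm := hasDerivAt_affine_rpow hm (show -ν = (1 - ν) - 1 by ring)
    exact ((((hasDerivAt_id' h).div_const 4).const_mul (2 - ν)).mul
      (dfm.add (dfp.const_add _))).sub (dFp.sub dFm)
  · rintro h ⟨hh, hh2⟩
    have hp : 0 < a + 2 + 1 * h := by linarith
    have hm : 0 < a + 2 + (-1) * h := by linarith
    have dfp := hasDerivAt_affine_rpow hp (show -ν = (1 - ν) - 1 by ring)
    have ddp := hasDerivAt_affine_rpow hp (show -ν - 1 = -ν - 1 by ring)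
    have dfm := hasDerivAt_affine_rpow hm (show -ν = (1 - ν) - 1 by ring)
    have ddm := hasDerivAt_affine_rpow hm (show -ν - 1 = -ν - 1 by ring)
    refine ((((dfm.add (dfp.const_add (6 * (a + 2) ^ (1 - ν)))).const_mul
      ((2 - ν) * (1 / 4))).add
      ((((hasDerivAt_id' h).div_const 4).const_mul (2 - ν)).mul
        ((ddm.const_mul ((1 - ν) * (-1))).add (ddp.const_mul ((1 - ν) * 1))))).sub
        ((dfp.const_mul ((2 - ν) * 1)).sub (dfm.const_mul ((2 - ν) * (-1))))).congr_deriv ?_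
    simp only [Pi.add_apply]
    rw [rpow_neg_eq_mul_rpow hp, rpow_neg_eq_mul_rpow hm]
    ring
  · rintro h ⟨hh, hh2⟩
    have hp : 0 < a + 2 + 1 * h := by linarith
    have hm : 0 < a + 2 + (-1) * h := by linarith
    have key := rpow_neg_sub_one_le hm (show a + 2 + (-1) * h ≤ a + 2 + 1 * h by linarith) h0 h1
    have hu := rpow_pos_of_pos hm (-ν - 1)
    have : 0 < 1 - ν := by linarith
    have : 0 < 2 - ν := by linarith
    refine mul_nonneg (by positivity) (sub_nonneg.2 ?_)
    refine le_of_mul_le_mul_right ?_ (pow_pos hp 2)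
    have h3 : 0 ≤ a + 2 + 1 * h + ν * h / 2 := by positivity
    have key2 := mul_le_mul_of_nonneg_right key h3
    have poly : (a + 2 + (-1) * h) * ((a + 2 + 1 * h) - ν * ((a + 2 + 1 * h) - (a + 2 + (-1) * h)))
        * (a + 2 + 1 * h + ν * h / 2)
        ≤ (a + 2 + (-1) * h - ν * h / 2) * (a + 2 + 1 * h) ^ 2 := by
      obtain ⟨c, rfl⟩ : ∃ c, a = c - 2 := ⟨a + 2, by ring⟩
      have hc : 0 ≤ c - 2 * h := by linarith
      have e1 : 0 ≤ ν * h * ((c + h) * (c - 2 * h)) := by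
        have : 0 ≤ c + h := by linarith
        positivity
      have e2 : 0 ≤ (c - h) * (ν * h) ^ 2 := by
        have : 0 ≤ c - h := by linarith
        positivity
      nlinarith
    have poly2 := mul_le_mul_of_nonneg_left poly hu.le
    linarith

lemma Dco_one_aux (h0 : 0 < ν) (h1 : ν < 1) {b : ℝ} (hb : 4 ≤ b) :
    -((2 - ν) / 2) * ((b - 2) ^ (1 - ν) + 3 * b ^ (1 - ν) - 4 * (b + 1) ^ (1 - ν))
      - (b - 2) ^ (2 - ν) + 3 * b ^ (2 - ν) - 2 * (b + 1) ^ (2 - ν) ≤ 0 := by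
  have := nonneg_of_second_deriv_nonneg (b := 1) (by norm_num)
    (g := fun h => (2 - ν) * (h / 2) * ((b + (-2) * h) ^ (1 - ν)
        + (3 * b ^ (1 - ν) + (-4) * (b + 1 * h) ^ (1 - ν)))
      + ((b + (-2) * h) ^ (2 - ν) + (-3 * b ^ (2 - ν) + 2 * (b + 1 * h) ^ (2 - ν))))
    (g' := fun h => ((2 - ν) * (1 / 2) * ((b + (-2) * h) ^ (1 - ν)
        + (3 * b ^ (1 - ν) + (-4) * (b + 1 * h) ^ (1 - ν)))
        + (2 - ν) * (h / 2) * ((1 - ν) * (-2) * (b + (-2) * h) ^ (-ν)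
          + (-4) * ((1 - ν) * 1 * (b + 1 * h) ^ (-ν))))
      + ((2 - ν) * (-2) * (b + (-2) * h) ^ (1 - ν)
        + 2 * ((2 - ν) * 1 * (b + 1 * h) ^ (1 - ν))))
    (g'' := fun h => 2 * (2 - ν) * (1 - ν) *
      ((b + (-2) * h) ^ (-ν - 1) * (b + (-2) * h - ν * h)
        - (b + 1 * h) ^ (-ν - 1) * (b + 1 * h - ν * h))) ?_ ?_ (by simp; ring)
    (by simp; ring) ?_
  · norm_num at this
    rw [show b + -2 = b - 2 by ring] at this
    linarith
  · rintro h ⟨hh, hh2⟩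
    have hp : 0 < b + 1 * h := by linarith
    have hm : 0 < b + (-2) * h := by linarith
    have dFp := hasDerivAt_affine_rpow hp (show 1 - ν = (2 - ν) - 1 by ring)
    have dfp := hasDerivAt_affine_rpow hp (show -ν = (1 - ν) - 1 by ring)
    have dFm := hasDerivAt_affine_rpow hm (show 1 - ν = (2 - ν) - 1 by ring)
    have dfm := hasDerivAt_affine_rpow hm (show -ν = (1 - ν) - 1 by ring)
    exact ((((hasDerivAt_id' h).div_const 2).const_mul (2 - ν)).mul
      (dfm.add ((dfp.const_mul (-4)).const_add _))).add
        (dFm.add ((dFp.const_mul 2).const_add _))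
  · rintro h ⟨hh, hh2⟩
    have hp : 0 < b + 1 * h := by linarith
    have hm : 0 < b + (-2) * h := by linarith
    have dfp := hasDerivAt_affine_rpow hp (show -ν = (1 - ν) - 1 by ring)
    have ddp := hasDerivAt_affine_rpow hp (show -ν - 1 = -ν - 1 by ring)
    have dfm := hasDerivAt_affine_rpow hm (show -ν = (1 - ν) - 1 by ring)
    have ddm := hasDerivAt_affine_rpow hm (show -ν - 1 = -ν - 1 by ring)
    refine ((((dfm.add ((dfp.const_mul (-4)).const_add (3 * b ^ (1 - ν)))).const_mul
      ((2 - ν) * (1 / 2))).add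
      ((((hasDerivAt_id' h).div_const 2).const_mul (2 - ν)).mul
        ((ddm.const_mul ((1 - ν) * (-2))).add
          ((ddp.const_mul ((1 - ν) * 1)).const_mul (-4))))).add
        ((dfm.const_mul ((2 - ν) * (-2))).add
          ((dfp.const_mul ((2 - ν) * 1)).const_mul 2))).congr_deriv ?_
    simp only [Pi.add_apply]
    rw [rpow_neg_eq_mul_rpow hp, rpow_neg_eq_mul_rpow hm]
    ring
  · rintro h ⟨hh, hh2⟩
    have hp : 0 < b + 1 * h := by linarith
    have hm : 0 < b + (-2) * h := by linarith
    have key := rpow_neg_sub_one_le hm (show b + (-2) * h ≤ b + 1 * h by linarith) h0 h1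
    have hu := rpow_pos_of_pos hm (-ν - 1)
    have : 0 < 1 - ν := by linarith
    have : 0 < 2 - ν := by linarith
    refine mul_nonneg (by positivity) (sub_nonneg.2 ?_)
    refine le_of_mul_le_mul_right ?_ (pow_pos hp 2)
    have hνh : ν * h ≤ h := by nlinarith
    have h3 : 0 ≤ b + 1 * h - ν * h := by linarith
    have key2 := mul_le_mul_of_nonneg_right key h3
    have poly : (b + (-2) * h) * ((b + 1 * h) - ν * ((b + 1 * h) - (b + (-2) * h)))
        * (b + 1 * h - ν * h)
        ≤ (b + (-2) * h - ν * h) * (b + 1 * h) ^ 2 := by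
      obtain ⟨a, rfl⟩ : ∃ a, b = a + 2 * h := ⟨b - 2 * h, by ring⟩
      have hc : 2 * h ≤ a := by linarith
      have e0 : 0 ≤ 3 * a ^ 2 + 6 * (a * h) - 9 * h ^ 2 - 3 * (a * (ν * h)) := by
        have : a * (ν * h) ≤ a * h := by
          refine mul_le_mul_of_nonneg_left hνh (by linarith)
        nlinarith
      have e1 : 0 ≤ ν * h * (3 * a ^ 2 + 6 * (a * h) - 9 * h ^ 2 - 3 * (a * (ν * h))) := by
        positivity
      nlinarith
    have poly2 := mul_le_mul_of_nonneg_left poly hu.le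
    linarith

lemma Dco_two_aux (h0 : 0 < ν) (h1 : ν < 1) {b : ℝ} (hb : 4 ≤ b) :
    ((2 - ν) / 2) * (4 * (b - 2) ^ (1 - ν) + 3 * b ^ (1 - ν) - (b + 1) ^ (1 - ν))
      + 2 * (b - 2) ^ (2 - ν) - 3 * b ^ (2 - ν) + (b + 1) ^ (2 - ν) ≤ 0 := by
  have := nonneg_of_second_deriv_nonneg (b := 1) (by norm_num)
    (g := fun h => (2 - ν) * (h / 2) * ((-4) * (b + (-2) * h) ^ (1 - ν)
        + (-3 * b ^ (1 - ν) + (b + 1 * h) ^ (1 - ν)))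
      + ((-2) * (b + (-2) * h) ^ (2 - ν) + (3 * b ^ (2 - ν) - (b + 1 * h) ^ (2 - ν))))
    (g' := fun h => ((2 - ν) * (1 / 2) * ((-4) * (b + (-2) * h) ^ (1 - ν)
        + (-3 * b ^ (1 - ν) + (b + 1 * h) ^ (1 - ν)))
        + (2 - ν) * (h / 2) * ((-4) * ((1 - ν) * (-2) * (b + (-2) * h) ^ (-ν))
          + (1 - ν) * 1 * (b + 1 * h) ^ (-ν)))
      + ((-2) * ((2 - ν) * (-2) * (b + (-2) * h) ^ (1 - ν))
        + -((2 - ν) * 1 * (b + 1 * h) ^ (1 - ν))))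
    (g'' := fun h => (2 - ν) * (1 - ν) * ν * h *
      (8 * (b + (-2) * h) ^ (-ν - 1) - 1 / 2 * (b + 1 * h) ^ (-ν - 1))) ?_ ?_ (by simp; ring)
    (by simp; ring) ?_
  · norm_num at this
    rw [show b + -2 = b - 2 by ring] at this
    linarith
  · rintro h ⟨hh, hh2⟩
    have hp : 0 < b + 1 * h := by linarith
    have hm : 0 < b + (-2) * h := by linarith
    have dFp := hasDerivAt_affine_rpow hp (show 1 - ν = (2 - ν) - 1 by ring)
    have dfp := hasDerivAt_affine_rpow hp (show -ν = (1 - ν) - 1 by ring)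
    have dFm := hasDerivAt_affine_rpow hm (show 1 - ν = (2 - ν) - 1 by ring)
    have dfm := hasDerivAt_affine_rpow hm (show -ν = (1 - ν) - 1 by ring)
    exact ((((hasDerivAt_id' h).div_const 2).const_mul (2 - ν)).mul
      ((dfm.const_mul (-4)).add (dfp.const_add _))).add
        ((dFm.const_mul (-2)).add (dFp.const_sub _))
  · rintro h ⟨hh, hh2⟩
    have hp : 0 < b + 1 * h := by linarith
    have hm : 0 < b + (-2) * h := by linarith
    have dfp := hasDerivAt_affine_rpow hp (show -ν = (1 - ν) - 1 by ring)
    have ddp := hasDerivAt_affine_rpow hp (show -ν - 1 = -ν - 1 by ring)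
    have dfm := hasDerivAt_affine_rpow hm (show -ν = (1 - ν) - 1 by ring)
    have ddm := hasDerivAt_affine_rpow hm (show -ν - 1 = -ν - 1 by ring)
    refine (((((dfm.const_mul (-4)).add (dfp.const_add (-3 * b ^ (1 - ν)))).const_mul
      ((2 - ν) * (1 / 2))).add
      ((((hasDerivAt_id' h).div_const 2).const_mul (2 - ν)).mul
        (((ddm.const_mul ((1 - ν) * (-2))).const_mul (-4)).add
          (ddp.const_mul ((1 - ν) * 1))))).add
        (((dfm.const_mul ((2 - ν) * (-2))).const_mul (-2)).add
          (dfp.const_mul ((2 - ν) * 1)).neg)).congr_deriv ?_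
    simp only [Pi.add_apply]
    ring
  · rintro h ⟨hh, hh2⟩
    have hp : 0 < b + 1 * h := by linarith
    have hm : 0 < b + (-2) * h := by linarith
    have key : (b + 1 * h) ^ (-ν - 1) ≤ (b + (-2) * h) ^ (-ν - 1) :=
      rpow_le_rpow_of_nonpos hm (by linarith) (by linarith)
    have hu := rpow_pos_of_pos hm (-ν - 1)
    have : 0 < 1 - ν := by linarith
    have : 0 < 2 - ν := by linarith
    have : 0 ≤ 8 * (b + (-2) * h) ^ (-ν - 1) - 1 / 2 * (b + 1 * h) ^ (-ν - 1) := by linarith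
    positivity

end

lemma transformed_sum_lt_one {θ : ℝ} {d : ℕ → ℝ} {n : ℕ} (hθ0 : 0 < θ) (hθ1 : θ < 1)
    (hsum : ∑ k ∈ range (n + 2), d k = 1) (hlast : d (n + 1) = 2 * θ)
    (hd : ∀ k < n, 0 ≤ d k) (hn : 0 < d n + θ ^ 2) :
    θ + ∑ k ∈ range (n + 1), (θ ^ (n + 2 - k) + ∑ i ∈ Icc k n, d i * θ ^ (i - k)) < 1 := by
  set e : ℕ → ℝ := fun k => θ ^ (n + 2 - k) + ∑ i ∈ Icc k n, d i * θ ^ (i - k) with he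
  have step : ∀ k ≤ n, e k = θ * e (k + 1) + d k := by
    intro k hk
    simp only [he]
    rw [← insert_Icc_add_one_left_eq_Icc hk, sum_insert (by simp), mul_add, mul_sum, ← pow_succ',
      show n + 2 - (k + 1) + 1 = n + 2 - k by omega]
    have : ∑ i ∈ Icc (k + 1) n, d i * θ ^ (i - k)
        = ∑ i ∈ Icc (k + 1) n, θ * (d i * θ ^ (i - (k + 1))) := by
      refine sum_congr rfl fun i hi => ?_
      have := (mem_Icc.1 hi).1
      rw [show i - k = i - (k + 1) + 1 by omega, pow_succ]
      ring
    rw [this]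
    simp
    ring
  have tele : ∀ N ≤ n + 1,
      (1 - θ) * ∑ k ∈ range N, e k = ∑ k ∈ range N, d k - θ * e 0 + θ * e N := by
    intro N
    induction N with
    | zero => simp
    | succ N ih =>
      intro hN
      rw [sum_range_succ, sum_range_succ, mul_add, ih (by omega)]
      linear_combination step N (by omega)
  have hend : e (n + 1) = θ := by simp [he, show n + 2 - (n + 1) = 1 by omega]
  have e0 : 0 < e 0 := by
    simp only [he, Nat.sub_zero, ← Nat.range_succ_eq_Icc_zero, sum_range_succ]
    have h1 : 0 ≤ ∑ i ∈ range n, d i * θ ^ i :=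
      sum_nonneg fun i hi => mul_nonneg (hd i (mem_range.1 hi)) (pow_nonneg hθ0.le _)
    have h2 : 0 < θ ^ n * (d n + θ ^ 2) := mul_pos (pow_pos hθ0 _) hn
    have h3 : θ ^ (n + 2) = θ ^ n * θ ^ 2 := pow_add _ _ _
    linarith
  have := tele (n + 1) le_rfl
  rw [sum_range_succ, hlast] at hsum
  rw [hend] at this
  have h4 := mul_pos hθ0 e0
  nlinarith

section
variable {ν : ℝ}

lemma Dbar_zero (m : ℕ) : Dbar ν m 0 = (1 / Real.Gamma (3 - ν)) *
    (-((2 - ν) / 2) * ((2 * m : ℝ) ^ (1 - ν) + 3 * ((2 * m : ℝ) + 2) ^ (1 - ν))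
      - (2 * m : ℝ) ^ (2 - ν) + ((2 * m : ℝ) + 2) ^ (2 - ν)) := by
  simp only [Dbar, if_true]

lemma Dbar_even (m i : ℕ) (hi : i ≠ 0) : Dbar ν m (2 * i) = (1 / Real.Gamma (3 - ν)) *
      (-((2 - ν) / 2) * (((2 * m : ℝ) - 2 * i) ^ (1 - ν)
          + 6 * ((2 * m : ℝ) - 2 * i + 2) ^ (1 - ν)
          + ((2 * m : ℝ) - 2 * i + 4) ^ (1 - ν))
        - ((2 * m : ℝ) - 2 * i) ^ (2 - ν)
        + ((2 * m : ℝ) - 2 * i + 4) ^ (2 - ν)) := by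
  rw [Dbar, if_neg (by omega), if_pos (by omega), show 2 * i / 2 = i by omega]

lemma Dbar_odd (m i : ℕ) : Dbar ν m (2 * i + 1) = (2 / Real.Gamma (3 - ν)) *
      ((2 - ν) * (((2 * m : ℝ) - 2 * i) ^ (1 - ν)
          + ((2 * m : ℝ) - 2 * i + 2) ^ (1 - ν))
        + ((2 * m : ℝ) - 2 * i) ^ (2 - ν)
        - ((2 * m : ℝ) - 2 * i + 2) ^ (2 - ν)) := by
  rw [Dbar, if_neg (by omega), if_neg (by omega), show (2 * i + 1) / 2 = i by omega]

lemma sum_Dbar (m K : ℕ) : ∑ k ∈ range (2 * K + 2), Dbar ν m k = (1 / Real.Gamma (3 - ν)) *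
    ((2 - ν) / 2 * (3 * ((2 * m : ℝ) - 2 * K) ^ (1 - ν) + ((2 * m : ℝ) - 2 * K + 2) ^ (1 - ν))
      + ((2 * m : ℝ) - 2 * K) ^ (2 - ν) - ((2 * m : ℝ) - 2 * K + 2) ^ (2 - ν)) := by
  induction K with
  | zero =>
    have h1 := Dbar_odd (ν := ν) m 0
    simp only [mul_zero, zero_add, CharP.cast_eq_zero, sub_zero] at h1
    simp only [mul_zero, zero_add, sum_range_succ, range_zero, sum_empty, Dbar_zero, h1,
      CharP.cast_eq_zero, sub_zero]
    ring
  | succ K ih =>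
    rw [show 2 * (K + 1) + 2 = 2 * K + 2 + 1 + 1 by ring, sum_range_succ, sum_range_succ, ih,
      show 2 * K + 2 = 2 * (K + 1) by ring, Dbar_even m (K + 1) (by omega),
      show 2 * K + 3 = 2 * (K + 1) + 1 by ring, Dbar_odd]
    push_cast
    rw [show (2 * m : ℝ) - 2 * (K + 1) + 2 = 2 * m - 2 * K by ring,
      show (2 * m : ℝ) - 2 * (K + 1) + 4 = 2 * m - 2 * K + 2 by ring]
    ring

lemma sum_Dco (m K : ℕ) : ∑ k ∈ range (2 * K + 3), Dco ν m k = (1 / Real.Gamma (3 - ν)) *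
    ((2 - ν) / 2 * (3 * ((2 * m : ℝ) - 2 * (K + 1)) ^ (1 - ν)
        + ((2 * m : ℝ) - 2 * K) ^ (1 - ν))
      + ((2 * m : ℝ) - 2 * (K + 1)) ^ (2 - ν) - ((2 * m : ℝ) - 2 * K) ^ (2 - ν)) := by
  induction K with
  | zero =>
    simp [sum_range_succ, Dco]
    ring
  | succ K ih =>
    rw [show 2 * (K + 1) + 3 = 2 * K + 3 + 1 + 1 by ring, sum_range_succ, sum_range_succ, ih,
      Dco, if_neg (by omega), if_neg (by omega), if_neg (by omega),
      Dco, if_neg (by omega), if_neg (by omega), if_neg (by omega),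
      show 2 * K + 3 + 1 = 2 * (K + 2) by ring, Dbar_even m (K + 2) (by omega), Dbar_odd]
    push_cast
    rw [show (2 * m : ℝ) - 2 * (K + 2) + 2 = 2 * m - 2 * (K + 1) by ring,
      show (2 * m : ℝ) - 2 * (K + 2) + 4 = 2 * m - 2 * K by ring,
      show (2 * m : ℝ) - 2 * (K + 1 + 1) = 2 * m - 2 * (K + 2) by ring]
    ring

lemma two_rpow_one_sub : (2 : ℝ) ^ (1 - ν) = 2 / 2 ^ ν := by
  rw [rpow_sub two_pos, rpow_one]

lemma two_rpow_two_sub : (2 : ℝ) ^ (2 - ν) = 4 / 2 ^ ν := by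
  rw [rpow_sub two_pos, rpow_two]
  norm_num

lemma Gamma_three_sub_pos (h1 : ν < 1) : 0 < Real.Gamma (3 - ν) :=
  Real.Gamma_pos_of_pos (by linarith)

lemma alpha0_pos_s7 (h0 : 0 < ν) (h1 : ν < 1) : 0 < alpha0 ν := by
  have := Gamma_three_sub_pos h1
  have := rpow_pos_of_pos two_pos ν
  unfold alpha0
  positivity

lemma theta_pos (h0 : 0 < ν) : 0 < theta ν := by
  unfold theta
  positivity

lemma theta_lt_one (h0 : 0 < ν) (h1 : ν < 1) : theta ν < 1 := by
  rw [theta, div_lt_one (by linarith)]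
  linarith

lemma sum_Dbar_eq (h1 : ν < 1) (m : ℕ) : ∑ k ∈ range (2 * m + 2), Dbar ν m k = -alpha0 ν := by
  have := Gamma_three_sub_pos h1
  have := rpow_pos_of_pos two_pos ν
  rw [sum_Dbar, sub_self, zero_rpow (by linarith), zero_rpow (by linarith), zero_add,
    two_rpow_one_sub, two_rpow_two_sub, alpha0]
  field_simp
  ring

lemma sum_Dco_eq (h1 : ν < 1) (K : ℕ) :
    ∑ k ∈ range (2 * K + 3), Dco ν (K + 1) k = -alpha0 ν := by
  have := Gamma_three_sub_pos h1
  have := rpow_pos_of_pos two_pos ν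
  rw [sum_Dco]
  push_cast
  rw [sub_self, zero_rpow (by linarith), zero_rpow (by linarith),
    show 2 * ((K : ℝ) + 1) - 2 * K = 2 by ring,
    two_rpow_one_sub, two_rpow_two_sub, alpha0]
  field_simp
  ring

lemma Dbar_last (h0 : 0 < ν) (h1 : ν < 1) (m : ℕ) :
    Dbar ν m (2 * m + 1) = -(2 * theta ν * alpha0 ν) := by
  have := Gamma_three_sub_pos h1
  have := rpow_pos_of_pos two_pos ν
  rw [Dbar_odd, sub_self, zero_rpow (by linarith), zero_rpow (by linarith), zero_add, zero_add,
    two_rpow_one_sub, two_rpow_two_sub, alpha0, theta]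
  field_simp
  ring

lemma two_rpow_lower (h0 : 0 < ν) (h1 : ν < 1) :
    12 + 8 * ν + ν ^ 2 < (12 - ν ^ 2) * 2 ^ ν := by
  have hL := Real.log_two_gt_d9
  have hE : 1 + 0.693 * ν + (0.693 * ν) ^ 2 / 2 ≤ (2 : ℝ) ^ ν := by
    rw [rpow_def_of_pos two_pos]
    refine (quadratic_le_exp_of_nonneg (by positivity)).trans (exp_le_exp.2 ?_)
    nlinarith
  have h2 : 0 < 12 - ν ^ 2 := by nlinarith
  refine lt_of_lt_of_le ?_ (mul_le_mul_of_nonneg_left hE h2.le)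
  have : 0 < ν * (0.316 + 0.88 * ν - 0.934 * ν ^ 2) := by
    apply mul_pos h0
    nlinarith
  nlinarith [mul_pos h0 (mul_pos h0 (mul_pos h0 (sub_pos.2 h1)))]

lemma Dbar_penultimate (h0 : 0 < ν) (h1 : ν < 1) {m : ℕ} (hm : m ≠ 0) :
    Dbar ν m (2 * m) < theta ν ^ 2 * alpha0 ν := by
  have hG := Gamma_three_sub_pos h1
  have hX := rpow_pos_of_pos two_pos ν
  have h4 : ∀ x : ℝ, (4 : ℝ) ^ x = 2 ^ x * 2 ^ x := fun x => by
    rw [← mul_rpow two_pos.le two_pos.le]; norm_num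
  rw [Dbar_even m m hm, sub_self, zero_rpow (by linarith), zero_rpow (by linarith), zero_add,
    zero_add, zero_add, h4, h4, two_rpow_one_sub, two_rpow_two_sub, alpha0, theta]
  have key := two_rpow_lower h0 h1
  generalize (2 : ℝ) ^ ν = X at *
  rw [← sub_pos]
  have e : (2 * ν / (2 + ν)) ^ 2 * ((ν + 2) / (X * Gamma (3 - ν)))
      - 1 / Gamma (3 - ν) * (-((2 - ν) / 2) * (6 * (2 / X) + 2 / X * (2 / X)) - 0
        + 4 / X * (4 / X))
      = 2 * ((12 - ν ^ 2) * X - (12 + 8 * ν + ν ^ 2)) / ((2 + ν) * X ^ 2 * Gamma (3 - ν)) := by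
    field_simp
    ring
  rw [e]
  have := sub_pos.2 key
  positivity

lemma Dbar_nonpos (h0 : 0 < ν) (h1 : ν < 1) {m k : ℕ} (hk : k < 2 * m) : Dbar ν m k ≤ 0 := by
  have hG := Gamma_three_sub_pos h1
  rcases Nat.even_or_odd' k with ⟨i, rfl | rfl⟩
  · rcases eq_or_ne i 0 with rfl | hi
    · rw [mul_zero, Dbar_zero]
      have : (1 : ℝ) ≤ m := by exact_mod_cast (by omega : 1 ≤ m)
      exact mul_nonpos_of_nonneg_of_nonpos (by positivity) (Dbar_zero_aux h0 h1 (by linarith))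
    · rw [Dbar_even m i hi]
      have : (i : ℝ) + 1 ≤ m := by exact_mod_cast (by omega : i + 1 ≤ m)
      exact mul_nonpos_of_nonneg_of_nonpos (by positivity) (Dbar_even_aux h0 h1 (by linarith))
  · rw [Dbar_odd]
    have : (i : ℝ) + 1 ≤ m := by exact_mod_cast (by omega : i + 1 ≤ m)
    exact mul_nonpos_of_nonneg_of_nonpos (by positivity) (trapezoid_rpow_le h0 h1 (by linarith))

lemma Dco_nonpos (h0 : 0 < ν) (h1 : ν < 1) {m k : ℕ} (hm : 2 ≤ m) (hk : k + 1 < 2 * m) :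
    Dco ν m k ≤ 0 := by
  have hG := Gamma_three_sub_pos h1
  have : (2 : ℝ) ≤ m := by exact_mod_cast hm
  rw [Dco]
  split_ifs with hk0 hk1 hk2
  · exact mul_nonpos_of_nonneg_of_nonpos (by positivity) (Dco_zero_aux h0 h1 (by linarith))
  · exact mul_nonpos_of_nonneg_of_nonpos (by positivity) (Dco_one_aux h0 h1 (by linarith))
  · exact mul_nonpos_of_nonneg_of_nonpos (by positivity) (Dco_two_aux h0 h1 (by linarith))
  · exact Dbar_nonpos h0 h1 hk

lemma Dco_of_three_le {m k : ℕ} (hk : 3 ≤ k) : Dco ν m k = Dbar ν m (k + 1) := by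
  rw [Dco, if_neg (by omega), if_neg (by omega), if_neg (by omega)]

/-- The bound for index at least four, in terms of the unnormalised coefficients `-α₀ d`. -/
lemma theta_add_sum_dbarco_lt_one (h0 : 0 < ν) (h1 : ν < 1) {n : ℕ} (hn : 2 ≤ n) {D : ℕ → ℝ}
    (hD : ∀ k, dco ν (n + 2) k = -D k / alpha0 ν)
    (hsum : ∑ k ∈ range (n + 2), D k = -alpha0 ν)
    (hlast : D (n + 1) = -(2 * theta ν * alpha0 ν))
    (hneg : ∀ k < n, D k ≤ 0) (hpen : D n < theta ν ^ 2 * alpha0 ν) :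
    theta ν + ∑ k ∈ range (n + 1), dbarco ν (n + 2) k < 1 := by
  have hα := alpha0_pos_s7 h0 h1
  have := transformed_sum_lt_one (d := dco ν (n + 2)) (n := n) (theta_pos h0) (theta_lt_one h0 h1)
    (by simp only [hD]
        rw [← sum_div, sum_neg_distrib, hsum, neg_neg, div_self hα.ne'])
    (by rw [hD, hlast]; field_simp)
    (fun k hk => by
      rw [hD]
      exact div_nonneg (neg_nonneg.2 (hneg k hk)) hα.le)
    (by rw [hD, neg_div, ← sub_eq_neg_add, sub_pos, div_lt_iff₀ hα]
        exact hpen)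
  convert this using 2
  refine sum_congr rfl fun k hk => ?_
  have := mem_range.1 hk
  rw [dbarco, if_neg (by omega), if_neg (by omega)]
  rfl

lemma theta_add_sum_dbarco_three (h0 : 0 < ν) (h1 : ν < 1) :
    theta ν + (dbarco ν 3 0 + dbarco ν 3 1) < 1 := by
  have hG := Gamma_three_sub_pos h1
  have hX := rpow_pos_of_pos two_pos ν
  have hY := rpow_pos_of_pos three_pos ν
  have key : (2 : ℝ) ^ ν ≤ (1 - ν / 3) * 3 ^ ν := by
    have h := rpow_one_add_le_one_add_mul_self (s := (-1 / 3 : ℝ)) (p := ν) (by norm_num) h0.le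
      h1.le
    rw [show (1 + -1 / 3 : ℝ) = 2 / 3 by norm_num, div_rpow two_pos.le three_pos.le,
      div_le_iff₀ hY] at h
    linarith
  have t1 : (3 : ℝ) ^ (1 - ν) = 3 / 3 ^ ν := by rw [rpow_sub three_pos, rpow_one]
  have t2 : (3 : ℝ) ^ (2 - ν) = 9 / 3 ^ ν := by
    rw [rpow_sub three_pos, rpow_two]; norm_num
  have z1 : (0 : ℝ) ^ (1 - ν) = 0 := zero_rpow (by linarith)
  have z2 : (0 : ℝ) ^ (2 - ν) = 0 := zero_rpow (by linarith)
  set W : ℝ := 2 ^ ν / 3 ^ ν with hW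
  have hW1 : W ≤ 1 - ν / 3 := by rwa [hW, div_le_iff₀ hY]
  have hW0 : 0 < W := by positivity
  have d2 : dco ν 3 2 = 3 - (6 + 3 / 2 * ν) * (W / (2 + ν)) := by
    norm_num [dco, Dco, t1, t2, z1, z2, two_rpow_one_sub, two_rpow_two_sub, alpha0]
    rw [hW]
    field_simp
    ring
  have d1 : dco ν 3 1 = -3 + (6 + 6 * ν) * (W / (2 + ν)) := by
    norm_num [dco, Dco, t1, t2, z1, z2, two_rpow_one_sub, two_rpow_two_sub, alpha0]
    rw [hW]
    field_simp
    ring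
  have d0 : dco ν 3 0 = 1 - 9 / 2 * ν * (W / (2 + ν)) := by
    norm_num [dco, Dco, t1, t2, z1, z2, two_rpow_one_sub, two_rpow_two_sub, alpha0]
    rw [hW]
    field_simp
    ring
  rw [← sub_pos]
  simp only [dbarco]
  norm_num
  rw [d2, d1, d0, theta]
  field_simp
  have hW2 : (48 + 60 * ν + 12 * ν ^ 2 + 9 * ν ^ 3) * W
      ≤ (48 + 60 * ν + 12 * ν ^ 2 + 9 * ν ^ 3) * (1 - ν / 3) := by gcongr
  have hν : 0 < ν * (12 - 4 * ν - 3 * ν ^ 2 + 3 * ν ^ 3) := by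
    have : 0 < ν ^ 3 := by positivity
    exact mul_pos h0 (by nlinarith)
  linarith

end

theorem stmt7 (ν : ℝ) (hν : ν ∈ Set.Ioo (0:ℝ) 1) (j : ℕ) (hj : 3 ≤ j) :
    theta ν + ∑ k ∈ Finset.range (j - 1), dbarco ν j k < 1 := by
  obtain ⟨h0, h1⟩ := hν
  rcases hj.eq_or_lt with rfl | hj
  · simpa [sum_range_succ] using theta_add_sum_dbarco_three h0 h1
  rcases Nat.even_or_odd' j with ⟨i, rfl | rfl⟩
  · obtain ⟨m, rfl⟩ : ∃ m, i = m + 1 := ⟨i - 1, by omega⟩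
    refine theta_add_sum_dbarco_lt_one h0 h1 (n := 2 * m) (D := Dbar ν m) (by omega)
      (fun k => ?_) (sum_Dbar_eq h1 m) (Dbar_last h0 h1 m) (fun k hk => Dbar_nonpos h0 h1 hk)
      (Dbar_penultimate h0 h1 (by omega))
    rw [dco, if_neg (by omega), show (2 * m + 2) / 2 - 1 = m by omega]
  · obtain ⟨m, rfl⟩ : ∃ m, i = m + 1 := ⟨i - 1, by omega⟩
    refine theta_add_sum_dbarco_lt_one h0 h1 (n := 2 * m + 1) (D := Dco ν (m + 1)) (by omega)
      (fun k => ?_) (sum_Dco_eq h1 m) ?_ (fun k hk => Dco_nonpos h0 h1 (by omega) (by omega)) ?_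
    · rw [dco, if_pos (by omega), show (2 * m + 1 + 2) / 2 = m + 1 by omega]
    · rw [Dco_of_three_le (by omega)]
      exact Dbar_last h0 h1 (m + 1)
    · rw [Dco_of_three_le (by omega)]
      exact Dbar_penultimate h0 h1 (by omega)
end
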